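/- Let G = (V,E) be a finite simple graph on n ≥ 7 vertices, and let (X_1, X_2) be a balanced partition such that no single swap of a vertex in X_1 with a vertex in X_2 decreases the cut size E(X_1,X_2). Then there is no set S ⊆ V with ⌊n/2⌋ ≤ |S| ≤ ⌈n/2⌉ such that every vertex i ∈ S satisfies E(i,S) > ((2n−4)/(n−6))·u_i(X). That is, (X_1,X_2) is in the ((2n−4)/(n−6), 0)-core. -/

import Mathlib

open Finset

/-- Number of neighbors of `i` inside the set `S`. -/
def nbrCount {V : Type*} [Fintype V] [DecidableEq V] (G : SimpleGraph V)
    [DecidableRel G.Adj] (i : V) (S : Finset V) : ℕ :=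
  (G.neighborFinset i ∩ S).card

/-- Number of edges (counted from `A`) between the sets `A` and `B`. -/
def cutCount {V : Type*} [Fintype V] [DecidableEq V] (G : SimpleGraph V)
    [DecidableRel G.Adj] (A B : Finset V) : ℕ :=
  ∑ i ∈ A, nbrCount G i B

section Counting

variable {V : Type*} [Fintype V] [DecidableEq V] (G : SimpleGraph V) [DecidableRel G.Adj]

theorem nbrCount_eq_sum (i : V) (S : Finset V) :
    nbrCount G i S = ∑ j ∈ S, if G.Adj i j then 1 else 0 := by
  rw [nbrCount, ← Finset.card_filter]
  congr 1
  ext j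
  simp [and_comm]

theorem nbrCount_mono (i : V) {S T : Finset V} (h : S ⊆ T) : nbrCount G i S ≤ nbrCount G i T :=
  card_le_card (inter_subset_inter_left h)

theorem nbrCount_insert (i : V) {j : V} {S : Finset V} (hj : j ∉ S) :
    nbrCount G i (insert j S) = (if G.Adj i j then 1 else 0) + nbrCount G i S := by
  simp only [nbrCount_eq_sum, sum_insert hj]

theorem nbrCount_union (i : V) {S T : Finset V} (h : Disjoint S T) :
    nbrCount G i (S ∪ T) = nbrCount G i S + nbrCount G i T := by
  simp only [nbrCount_eq_sum, sum_union h]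

theorem cutCount_comm (A B : Finset V) : cutCount G A B = cutCount G B A := by
  simp only [cutCount, nbrCount_eq_sum]
  rw [sum_comm]
  simp only [G.adj_comm]

theorem cutCount_insert_left {i : V} {A : Finset V} (hi : i ∉ A) (B : Finset V) :
    cutCount G (insert i A) B = nbrCount G i B + cutCount G A B := by
  simp only [cutCount, sum_insert hi]

theorem cutCount_insert_right (A : Finset V) {j : V} {B : Finset V} (hj : j ∉ B) :
    cutCount G A (insert j B) = nbrCount G j A + cutCount G A B := by
  rw [cutCount_comm, cutCount_insert_left G hj, cutCount_comm G B A]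

/-- If swapping `i ∈ A` with `j ∈ B` does not decrease the cut, then the external degrees of `i`
and `j` exceed their internal degrees by at most twice the number of edges joining them. -/
theorem nbrCount_add_le_of_cutCount_le_swap {A B : Finset V} (h : Disjoint A B) {i j : V}
    (hi : i ∈ A) (hj : j ∈ B)
    (hs : cutCount G A B ≤ cutCount G (insert j (A.erase i)) (insert i (B.erase j))) :
    nbrCount G i B + nbrCount G j A ≤
      nbrCount G i A + nbrCount G j B + 2 * (if G.Adj i j then 1 else 0) := by
  have hiB : i ∉ B := disjoint_left.1 h hi
  have hjA : j ∉ A := disjoint_right.1 h hj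
  obtain ⟨A, hiA', rfl⟩ : ∃ A', i ∉ A' ∧ insert i A' = A :=
    ⟨A.erase i, notMem_erase i A, insert_erase hi⟩
  obtain ⟨B, hjB', rfl⟩ : ∃ B', j ∉ B' ∧ insert j B' = B :=
    ⟨B.erase j, notMem_erase j B, insert_erase hj⟩
  have hiB' : i ∉ B := fun hx => hiB (mem_insert_of_mem hx)
  have hjA' : j ∉ A := fun hx => hjA (mem_insert_of_mem hx)
  rw [erase_insert hiA', erase_insert hjB', cutCount_insert_left G hiA',
    cutCount_insert_left G hjA', cutCount_insert_right G A hjB', cutCount_insert_right G A hiB',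
    nbrCount_insert G i hjB', nbrCount_insert G j hiB'] at hs
  rw [nbrCount_insert G i hjB', nbrCount_insert G j hiA', nbrCount_insert G i hiA',
    nbrCount_insert G j hjB']
  simp only [G.adj_comm j i, SimpleGraph.irrefl, if_false] at hs ⊢
  omega

/-- The swap inequalities summed over `P × Q`. -/
theorem card_mul_cutCount_le_of_swap {A B P Q : Finset V} (h : Disjoint A B) (hP : P ⊆ A)
    (hQ : Q ⊆ B)
    (hs : ∀ i ∈ A, ∀ j ∈ B,
      cutCount G A B ≤ cutCount G (insert j (A.erase i)) (insert i (B.erase j))) :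
    (#P + #Q) * cutCount G P Q ≤
      #Q * cutCount G P A + #P * cutCount G Q B + 2 * cutCount G P Q := by
  have key : ∑ i ∈ P, ∑ j ∈ Q, (nbrCount G i Q + nbrCount G j P) ≤
      ∑ i ∈ P, ∑ j ∈ Q,
        (nbrCount G i A + nbrCount G j B + 2 * (if G.Adj i j then 1 else 0)) :=
    sum_le_sum fun i hi => sum_le_sum fun j hj =>
      (add_le_add (nbrCount_mono G i hQ) (nbrCount_mono G j hP)).trans
        (nbrCount_add_le_of_cutCount_le_swap G h (hP hi) (hQ hj) (hs i (hP hi) j (hQ hj)))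
  simp only [sum_add_distrib, sum_const, smul_eq_mul, ← mul_sum, ← nbrCount_eq_sum] at key
  simp only [← cutCount.eq_1, cutCount_comm G Q P] at key
  linarith

/-- A part `P ⊆ A` whose members all multiply their internal degree by more than `c` inside
`P ∪ Q` has many edges to `Q`. -/
theorem mul_cutCount_lt_of_forall_lt {A P Q : Finset V} (hP : P ⊆ A) (hPQ : Disjoint P Q)
    (hne : P.Nonempty) {c : ℝ}
    (hc : ∀ i ∈ P, c * nbrCount G i A < nbrCount G i (P ∪ Q)) :
    (c - 1) * cutCount G P A < cutCount G P Q := by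
  simp only [cutCount, Nat.cast_sum, mul_sum]
  refine sum_lt_sum_of_nonempty hne fun i hi => ?_
  have h1 := hc i hi
  have h2 : (nbrCount G i P : ℝ) ≤ nbrCount G i A := mod_cast nbrCount_mono G i hP
  rw [nbrCount_union G i hPQ] at h1
  push_cast at h1
  linarith

/-- A set all of whose members more than multiply by `c ≥ 1` their degree into `A` is not
contained in `A`. -/
theorem not_subset_of_forall_mul_lt {A S : Finset V} (hne : S.Nonempty) {c : ℝ} (h1 : 1 ≤ c)
    (hc : ∀ i ∈ S, i ∈ A → c * nbrCount G i A < nbrCount G i S) : ¬ S ⊆ A := by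
  intro hS
  obtain ⟨i, hi⟩ := hne
  have h2 : (nbrCount G i S : ℝ) ≤ nbrCount G i A := mod_cast nbrCount_mono G i hS
  nlinarith [hc i hi (hS hi), Nat.cast_nonneg (α := ℝ) (nbrCount G i A)]

end Counting

theorem stmt_10 {V : Type*} [Fintype V] [DecidableEq V] (G : SimpleGraph V)
    [DecidableRel G.Adj] (n : ℕ) (hn : n = Fintype.card V) (hn7 : 7 ≤ n)
    (X1 X2 : Finset V) (hdisj : Disjoint X1 X2) (hcover : X1 ∪ X2 = univ)
    (hbal : (X1.card : ℤ) - X2.card ≤ 1 ∧ (X2.card : ℤ) - X1.card ≤ 1)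
    (hswap : ∀ i ∈ X1, ∀ j ∈ X2,
      cutCount G X1 X2 ≤
        cutCount G (insert j (X1.erase i)) (insert i (X2.erase j))) :
    ¬ ∃ S : Finset V, n / 2 ≤ S.card ∧ S.card ≤ (n + 1) / 2 ∧
      ∀ i ∈ S,
        (i ∈ X1 → (nbrCount G i S : ℝ) >
          ((2 * (n : ℝ) - 4) / ((n : ℝ) - 6)) * nbrCount G i X1) ∧
        (i ∈ X2 → (nbrCount G i S : ℝ) >
          ((2 * (n : ℝ) - 4) / ((n : ℝ) - 6)) * nbrCount G i X2) := by
  rintro ⟨S, hlo, -, hS⟩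
  have hs3 : 3 ≤ #S := by omega
  have hnS : (n : ℝ) ≤ 2 * #S + 1 := by
    have : n ≤ 2 * #S + 1 := by omega
    exact_mod_cast this
  have hn7' : (7 : ℝ) ≤ n := by exact_mod_cast hn7
  set c : ℝ := (2 * (n : ℝ) - 4) / ((n : ℝ) - 6) with hcdef
  have hc : c * (n - 6) = 2 * n - 4 := div_mul_cancel₀ _ (by linarith)
  have hc1 : 1 ≤ c := by
    rw [hcdef, one_le_div (by linarith)]
    linarith
  have hSne : S.Nonempty := card_pos.1 (by omega)
  set P := S ∩ X1 with hPdef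
  set Q := S ∩ X2 with hQdef
  have hPX : P ⊆ X1 := inter_subset_right
  have hQX : Q ⊆ X2 := inter_subset_right
  have hPQ : Disjoint P Q := hdisj.mono hPX hQX
  have hU : P ∪ Q = S := by rw [hPdef, hQdef, ← inter_union_distrib_left, hcover, inter_univ]
  have hPne : P.Nonempty := by
    rw [nonempty_iff_ne_empty]
    intro h
    rw [h, empty_union] at hU
    exact not_subset_of_forall_mul_lt G hSne hc1 (fun i hi => (hS i hi).2) (hU ▸ hQX)
  have hQne : Q.Nonempty := by
    rw [nonempty_iff_ne_empty]
    intro h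
    rw [h, union_empty] at hU
    exact not_subset_of_forall_mul_lt G hSne hc1 (fun i hi => (hS i hi).1) (hU ▸ hPX)
  have hP := mul_cutCount_lt_of_forall_lt G (c := c) hPX hPQ hPne fun i hi => by
    rw [hU]
    exact (hS i (inter_subset_left hi)).1 (hPX hi)
  have hQ := mul_cutCount_lt_of_forall_lt G (c := c) hQX hPQ.symm hQne fun i hi => by
    rw [union_comm, hU]
    exact (hS i (inter_subset_left hi)).2 (hQX hi)
  rw [cutCount_comm G Q P] at hQ
  have hsum : ((#P : ℝ) + #Q) * cutCount G P Q ≤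
      #Q * cutCount G P X1 + #P * cutCount G Q X2 + 2 * cutCount G P Q := by
    exact_mod_cast card_mul_cutCount_le_of_swap G hdisj hPX hQX hswap
  have hcard : (#S : ℝ) = #P + #Q := by
    rw [← hU]
    exact_mod_cast card_union_of_disjoint hPQ
  have hp : (0 : ℝ) < #P := by exact_mod_cast hPne.card_pos
  have hq : (0 : ℝ) < #Q := by exact_mod_cast hQne.card_pos
  have hE : (0 : ℝ) < cutCount G P Q :=
    (mul_nonneg (sub_nonneg.2 hc1) (Nat.cast_nonneg _)).trans_lt hP
  have hlt : (c - 1) * (#S - 2) * cutCount G P Q < #S * cutCount G P Q := by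
    have h1 := mul_lt_mul_of_pos_left hP hq
    have h2 := mul_lt_mul_of_pos_left hQ hp
    have h3 := mul_le_mul_of_nonneg_left hsum (sub_nonneg.2 hc1)
    rw [hcard]
    linarith
  have hlt' : (c - 1) * (#S - 2) < #S := lt_of_mul_lt_mul_right hlt hE.le
  have h6 : (0 : ℝ) < n - 6 := by linarith
  have hmul := mul_lt_mul_of_pos_right hlt' h6
  have heq : (c - 1) * (#S - 2) * (n - 6) = (n + 2) * ((#S : ℝ) - 2) := by
    linear_combination ((#S : ℝ) - 2) * hc
  linarith
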